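/- Let H be a group with a finite generating set T, let G₀ be a group with a finite generating set C, let L ≤ H be a subgroup, and let φ : L → G₀ be a homomorphism such that |φ(l)|_C ≤ |l|_T for every l ∈ L. Let K = ⟨H × G₀, s | s⁻¹(l,g)s = (l, φ(l)g) for all l ∈ L, g ∈ Z(G₀)⟩ be the HNN extension of H × G₀ with stable letter s, associated subgroups L × Z(G₀) and ψ(L × Z(G₀)), and isomorphism ψ(l, g) = (l, φ(l)·g), with canonical embedding ι : H × G₀ → K. Endow K with the word metric with respect to the finite generating set D = ι({(y,1) : y ∈ T}) ∪ ι({(1,c) : c ∈ C}) ∪ {s}. Then for every g ∈ G₀, |g|_C ≤ (|ι(1,g)|_D)². -/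

import Mathlib

/-- The word length of `g` with respect to a generating set `S`: the least `n` such that
`g` is a product of `n` elements of `S ∪ S⁻¹`. -/
noncomputable def wordLength {G : Type*} [Group G] (S : Set G) (g : G) : ℕ :=
  sInf {n | ∃ l : List G, (∀ x ∈ l, x ∈ S ∪ S⁻¹) ∧ l.length = n ∧ l.prod = g}

section WordLength

variable {G : Type*} [Group G] {S : Set G}

theorem wordLength_le_length {l : List G} (hl : ∀ x ∈ l, x ∈ S ∪ S⁻¹) :
    wordLength S l.prod ≤ l.length :=
  Nat.sInf_le ⟨l, hl, rfl, rfl⟩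

theorem exists_list_length_eq_wordLength (hS : Subgroup.closure S = ⊤) (g : G) :
    ∃ l : List G, (∀ x ∈ l, x ∈ S ∪ S⁻¹) ∧ l.length = wordLength S g ∧ l.prod = g := by
  have hg : g ∈ Submonoid.closure (S ∪ S⁻¹) := by
    rw [← Subgroup.closure_toSubmonoid, hS]
    exact Subgroup.mem_top g
  obtain ⟨l, hl, rfl⟩ := Submonoid.exists_list_of_mem_closure hg
  exact Nat.sInf_mem (s := {n | ∃ l' : List G, (∀ x ∈ l', x ∈ S ∪ S⁻¹) ∧ l'.length = n ∧
    l'.prod = l.prod}) ⟨_, l, hl, rfl, rfl⟩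

theorem wordLength_one : wordLength S (1 : G) = 0 :=
  Nat.le_zero.mp (wordLength_le_length (S := S) (l := []) (by simp))

theorem wordLength_le_one {g : G} (hg : g ∈ S ∪ S⁻¹) : wordLength S g ≤ 1 := by
  simpa using wordLength_le_length (S := S) (l := [g]) (by simpa using hg)

theorem wordLength_mul_le (hS : Subgroup.closure S = ⊤) (g h : G) :
    wordLength S (g * h) ≤ wordLength S g + wordLength S h := by
  obtain ⟨l, hl, hlen, hprod⟩ := exists_list_length_eq_wordLength hS g
  obtain ⟨m, hm, hlen', hprod'⟩ := exists_list_length_eq_wordLength hS h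
  rw [← hlen, ← hlen', ← hprod, ← hprod', ← List.length_append, ← List.prod_append]
  refine wordLength_le_length fun x hx => ?_
  rcases List.mem_append.mp hx with hx | hx
  exacts [hl x hx, hm x hx]

theorem wordLength_inv_le (hS : Subgroup.closure S = ⊤) (g : G) :
    wordLength S g⁻¹ ≤ wordLength S g := by
  obtain ⟨l, hl, hlen, hprod⟩ := exists_list_length_eq_wordLength hS g
  have hlen' : (l.map (·⁻¹)).reverse.length = wordLength S g := by simpa using hlen
  rw [← hlen', ← hprod, List.prod_inv_reverse]
  refine wordLength_le_length fun x hx => ?_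
  obtain ⟨y, hy, rfl⟩ : ∃ y ∈ l, y⁻¹ = x := by simpa using hx
  simpa [or_comm] using hl y hy

end WordLength

namespace HNNExtension

variable {G : Type*} [Group G] {A B : Subgroup G} {φ : A ≃* B}

theorem t_zpow_units_mul_of (u : ℤˣ) (a : toSubgroup A B u) :
    (t ^ (u : ℤ) * of (a : G) : HNNExtension G A B φ) =
      of (toSubgroupEquiv φ u a : G) * t ^ (u : ℤ) := by
  rcases Int.units_eq_one_or u with rfl | rfl
  · rw [Units.val_one, zpow_one]
    exact t_mul_of a
  · rw [Units.val_neg, Units.val_one, zpow_neg_one]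
    exact inv_t_mul_of a

/-- The element `g * t ^ u₁ * g₁ * ⋯ * t ^ uₙ * gₙ` of the HNN extension. -/
def syllableProd (φ : A ≃* B) (g : G) (l : List (ℤˣ × G)) : HNNExtension G A B φ :=
  of g * (l.map fun x => t ^ (x.1 : ℤ) * of x.2).prod

/-- The total weight of the base group elements of a syllable decomposition. -/
def syllableWeight (p : G → ℕ) (g : G) (l : List (ℤˣ × G)) : ℕ :=
  p g + (l.map fun x => p x.2).sum

theorem syllableProd_cons (g a : G) (u : ℤˣ) (l : List (ℤˣ × G)) :
    syllableProd φ g ((u, a) :: l) = of g * t ^ (u : ℤ) * syllableProd φ a l := by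
  simp [syllableProd, mul_assoc]

theorem of_mul_syllableProd (g h : G) (l : List (ℤˣ × G)) :
    of g * syllableProd φ h l = syllableProd φ (g * h) l := by
  simp [syllableProd, mul_assoc]

omit [Group G] in
theorem syllableWeight_cons (p : G → ℕ) (g a : G) (u : ℤˣ) (l : List (ℤˣ × G)) :
    syllableWeight p g ((u, a) :: l) = p g + syllableWeight p a l := by
  simp [syllableWeight]

theorem syllableWeight_mul_le {p : G → ℕ} (hp : ∀ g h, p (g * h) ≤ p g + p h) (g h : G)
    (l : List (ℤˣ × G)) : syllableWeight p (g * h) l ≤ p g + syllableWeight p h l := by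
  have := hp g h
  simp only [syllableWeight]
  omega

/-- Britton's lemma: a syllable decomposition of an element of the base group has a pinch. -/
theorem not_isChain_of_syllableProd_eq_of {g k : G} {l : List (ℤˣ × G)} (hl : l ≠ [])
    (h : syllableProd φ g l = of k) :
    ¬ l.IsChain (fun a b => a.2 ∈ toSubgroup A B a.1 → a.1 = b.1) := fun hc =>
  hl (ReducedWord.toList_eq_nil_of_mem_of_range φ (⟨g, l, hc⟩ : NormalWord.ReducedWord G A B)
    ⟨k, h.symm⟩)

section Weights

variable {p q : G → ℕ} (hp : ∀ g h, p (g * h) ≤ p g + p h) (hq : ∀ g h, q (g * h) ≤ q g + q h)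
  (hpφ : ∀ (u : ℤˣ) (a : toSubgroup A B u), p (toSubgroupEquiv φ u a) ≤ p a)
  (hqφ : ∀ (u : ℤˣ) (a : toSubgroup A B u), q (toSubgroupEquiv φ u a) ≤ q a + p a)

include hp hq hpφ hqφ

/-- Removing a pinch does not increase the `p`-weight, and increases the `q`-weight by at most the
`p`-weight. -/
theorem exists_remove_pinch (l : List (ℤˣ × G)) (g : G)
    (hl : ¬ l.IsChain (fun a b => a.2 ∈ toSubgroup A B a.1 → a.1 = b.1)) :
    ∃ (g' : G) (l' : List (ℤˣ × G)), syllableProd φ g' l' = syllableProd φ g l ∧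
      l'.length + 2 = l.length ∧ syllableWeight p g' l' ≤ syllableWeight p g l ∧
      syllableWeight q g' l' ≤ syllableWeight q g l + syllableWeight p g l := by
  induction l generalizing g with
  | nil => exact absurd List.isChain_nil hl
  | cons x l ih =>
    obtain ⟨u, a⟩ := x
    by_cases hc : l.IsChain (fun a b => a.2 ∈ toSubgroup A B a.1 → a.1 = b.1)
    · cases l with
      | nil => exact absurd (List.isChain_singleton _) hl
      | cons y l =>
        obtain ⟨v, b⟩ := y
        rw [List.isChain_cons_cons] at hl
        obtain ⟨ha, huv⟩ : a ∈ toSubgroup A B u ∧ u ≠ v := by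
          simpa [hc] using hl
        obtain rfl : v = -u := by
          rcases Int.units_eq_one_or u with rfl | rfl <;>
          rcases Int.units_eq_one_or v with rfl | rfl <;> simp_all
        set c : G := ((toSubgroupEquiv φ u ⟨a, ha⟩ : toSubgroup A B (-u)) : G)
        have hpc : p c ≤ p a := hpφ u ⟨a, ha⟩
        have hqc : q c ≤ q a + p a := hqφ u ⟨a, ha⟩
        refine ⟨g * (c * b), l, ?_, by simp, ?_, ?_⟩
        · have hpinch : (of c : HNNExtension G A B φ) =
              t ^ (u : ℤ) * of a * t ^ ((-u : ℤˣ) : ℤ) := by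
            rw [Units.val_neg, zpow_neg]
            exact eq_mul_inv_of_mul_eq (t_zpow_units_mul_of u ⟨a, ha⟩).symm
          rw [syllableProd_cons, syllableProd_cons, ← of_mul_syllableProd,
            ← of_mul_syllableProd, hpinch]
          simp only [mul_assoc]
        · have h₁ := syllableWeight_mul_le hp g (c * b) l
          have h₂ := syllableWeight_mul_le hp c b l
          simp only [syllableWeight_cons]
          omega
        · have h₁ := syllableWeight_mul_le hq g (c * b) l
          have h₂ := syllableWeight_mul_le hq c b l
          simp only [syllableWeight_cons]
          omega
    · obtain ⟨g', l', hprod, hlen, hpw, hqw⟩ := ih a hc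
      refine ⟨g, (u, g') :: l', ?_, ?_, ?_, ?_⟩
      · rw [syllableProd_cons, syllableProd_cons, hprod]
      · simpa using hlen
      · simp only [syllableWeight_cons]
        omega
      · simp only [syllableWeight_cons]
        omega

theorem weight_le_of_syllableProd_eq_of (n : ℕ) {g k : G} {l : List (ℤˣ × G)}
    (hn : l.length ≤ n) (h : syllableProd φ g l = of k) :
    q k ≤ syllableWeight q g l + n * syllableWeight p g l := by
  induction n using Nat.strong_induction_on generalizing g l with
  | _ n ih =>
    by_cases hl : l = []
    · subst hl
      obtain rfl : g = k := of_injective φ (by simpa [syllableProd] using h)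
      simp [syllableWeight]
    · obtain ⟨g', l', hprod, hlen, hpw, hqw⟩ := exists_remove_pinch hp hq hpφ hqφ l g
        (not_isChain_of_syllableProd_eq_of hl h)
      obtain ⟨m, rfl⟩ : ∃ m, n = m + 1 := ⟨n - 1, by omega⟩
      have hk := ih m (by omega) (g := g') (l := l') (by omega) (hprod.trans h)
      have hm := Nat.mul_le_mul_left m hpw
      rw [Nat.add_mul, Nat.one_mul]
      omega

omit hpφ hqφ in
theorem exists_syllableProd_eq_prod (hp₁ : p 1 = 0) (hq₁ : q 1 = 0)
    (w : List (HNNExtension G A B φ))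
    (hw : ∀ x ∈ w, (∃ g, x = of g ∧ q g + p g ≤ 1) ∨ ∃ u : ℤˣ, x = t ^ (u : ℤ)) :
    ∃ (g : G) (l : List (ℤˣ × G)), syllableProd φ g l = w.prod ∧
      syllableWeight q g l + syllableWeight p g l + l.length ≤ w.length := by
  induction w with
  | nil => exact ⟨1, [], by simp [syllableProd], by simp [syllableWeight, hp₁, hq₁]⟩
  | cons x w ih =>
    obtain ⟨g, l, hprod, hlen⟩ := ih fun y hy => hw y (List.mem_cons_of_mem x hy)
    rcases hw x List.mem_cons_self with ⟨a, rfl, ha⟩ | ⟨u, rfl⟩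
    · refine ⟨a * g, l, by rw [← of_mul_syllableProd, hprod, List.prod_cons], ?_⟩
      have h₁ := syllableWeight_mul_le hp a g l
      have h₂ := syllableWeight_mul_le hq a g l
      rw [List.length_cons]
      omega
    · refine ⟨1, (u, g) :: l, by simp [syllableProd_cons, hprod], ?_⟩
      simp only [syllableWeight_cons, List.length_cons]
      omega

/-- If conjugation by `t` does not increase `p` and increases `q` by at most `p`, then `q` of an
element of the base group is at most quadratic in the length of any word representing it. -/
theorem weight_le_length_sq (hp₁ : p 1 = 0) (hq₁ : q 1 = 0)
    {w : List (HNNExtension G A B φ)}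
    (hw : ∀ x ∈ w, (∃ g, x = of g ∧ q g + p g ≤ 1) ∨ ∃ u : ℤˣ, x = t ^ (u : ℤ))
    {k : G} (hk : w.prod = of k) : q k ≤ w.length ^ 2 := by
  obtain ⟨g, l, hprod, hlen⟩ := exists_syllableProd_eq_prod hp hq hp₁ hq₁ w hw
  refine (weight_le_of_syllableProd_eq_of hp hq hpφ hqφ _ le_rfl (hprod.trans hk)).trans ?_
  refine le_trans ?_ (Nat.pow_le_pow_left hlen 2)
  nlinarith [Nat.le_self_pow two_ne_zero (syllableWeight q g l)]

end Weights

theorem closure_of_image_union_t {S : Set G} (hS : Subgroup.closure S = ⊤) :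
    Subgroup.closure (of '' S ∪ {t} : Set (HNNExtension G A B φ)) = ⊤ := by
  refine eq_top_iff.mpr fun x _ => ?_
  induction x using induction_on with
  | of g =>
    have hg : of g ∈ (Subgroup.closure S).map (of : G →* HNNExtension G A B φ) :=
      Subgroup.mem_map_of_mem _ (hS ▸ Subgroup.mem_top g)
    rw [MonoidHom.map_closure] at hg
    exact Subgroup.closure_mono Set.subset_union_left hg
  | t => exact Subgroup.subset_closure (Or.inr rfl)
  | mul x y hx hy => exact mul_mem (hx trivial) (hy trivial)
  | inv x hx => exact inv_mem (hx trivial)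

end HNNExtension

theorem Subgroup.closure_prodMk_one_union_one_prodMk {H G : Type*} [Group H] [Group G]
    {S : Set H} {T : Set G} (hS : Subgroup.closure S = ⊤) (hT : Subgroup.closure T = ⊤) :
    Subgroup.closure ((fun y : H => (y, (1 : G))) '' S ∪ (fun c : G => ((1 : H), c)) '' T) = ⊤ := by
  refine eq_top_iff.mpr fun x _ => ?_
  have h₁ : MonoidHom.inl H G x.1 ∈ (Subgroup.closure S).map (MonoidHom.inl H G) :=
    Subgroup.mem_map_of_mem _ (hS ▸ Subgroup.mem_top _)
  have h₂ : MonoidHom.inr H G x.2 ∈ (Subgroup.closure T).map (MonoidHom.inr H G) :=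
    Subgroup.mem_map_of_mem _ (hT ▸ Subgroup.mem_top _)
  rw [MonoidHom.map_closure] at h₁ h₂
  have hx : x = MonoidHom.inl H G x.1 * MonoidHom.inr H G x.2 := by ext <;> simp
  rw [hx]
  exact mul_mem (Subgroup.closure_mono Set.subset_union_left h₁)
    (Subgroup.closure_mono Set.subset_union_right h₂)


theorem stmt_9 (H G₀ : Type) [Group H] [Group G₀]
    (T : Finset H) (hT : Subgroup.closure (T : Set H) = ⊤)
    (C : Finset G₀) (hC : Subgroup.closure (C : Set G₀) = ⊤)
    (L : Subgroup H) (φ : L →* G₀)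
    (hφ : ∀ l : L, wordLength (C : Set G₀) (φ l) ≤ wordLength (T : Set H) (l : H))
    (Q : Subgroup (H × G₀))
    (ψ : (L.prod (Subgroup.center G₀)) ≃* Q)
    (hψ : ∀ x : (L.prod (Subgroup.center G₀)),
      ((ψ x : H × G₀)) =
        ((x : H × G₀).1,
          φ ⟨(x : H × G₀).1, (Subgroup.mem_prod.mp x.2).1⟩ * (x : H × G₀).2)) :
    ∀ g : G₀,
      wordLength (C : Set G₀) g ≤
        (wordLength
          (((fun y : H => (HNNExtension.of (y, (1 : G₀)) :
              HNNExtension (H × G₀) (L.prod (Subgroup.center G₀)) Q ψ)) '' (T : Set H)) ∪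
           ((fun c : G₀ => (HNNExtension.of ((1 : H), c) :
              HNNExtension (H × G₀) (L.prod (Subgroup.center G₀)) Q ψ)) '' (C : Set G₀)) ∪
           {HNNExtension.t})
          (HNNExtension.of ((1 : H), g))) ^ 2 := by
  intro g
  set D : Set (HNNExtension (H × G₀) (L.prod (Subgroup.center G₀)) Q ψ) := _ ∪ {HNNExtension.t}
    with hD
  have hDtop : Subgroup.closure D = ⊤ := by
    have := HNNExtension.closure_of_image_union_t (φ := ψ)
      (Subgroup.closure_prodMk_one_union_one_prodMk hT hC)
    rwa [Set.image_union, Set.image_image, Set.image_image] at this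
  obtain ⟨w, hw, hlen, hprod⟩ :=
    exists_list_length_eq_wordLength hDtop (HNNExtension.of ((1 : H), g))
  rw [← hlen]
  refine HNNExtension.weight_le_length_sq (φ := ψ) (k := ((1 : H), g))
    (p := fun x => wordLength (T : Set H) x.1) (q := fun x => wordLength (C : Set G₀) x.2)
    (fun x y => wordLength_mul_le hT x.1 y.1) (fun x y => wordLength_mul_le hC x.2 y.2)
    ?_ ?_ wordLength_one wordLength_one ?_ hprod
  · intro u a
    rcases Int.units_eq_one_or u with rfl | rfl
    · exact (congrArg (fun x : H × G₀ => wordLength (T : Set H) x.1) (hψ a)).le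
    · obtain ⟨x, rfl⟩ := ψ.surjective a
      change wordLength _ (ψ.symm (ψ x) : H × G₀).1 ≤ _
      rw [ψ.symm_apply_apply]
      exact (congrArg (fun x : H × G₀ => wordLength (T : Set H) x.1) (hψ x)).ge
  · intro u a
    rcases Int.units_eq_one_or u with rfl | rfl
    · have h₁ := hφ ⟨(a : H × G₀).1, (Subgroup.mem_prod.mp a.2).1⟩
      have h₂ := wordLength_mul_le hC (φ ⟨(a : H × G₀).1, (Subgroup.mem_prod.mp a.2).1⟩)
        (a : H × G₀).2
      change wordLength _ (ψ a : H × G₀).2 ≤ _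
      rw [hψ a]
      dsimp only at h₁ h₂ ⊢
      omega
    · obtain ⟨x, rfl⟩ := ψ.surjective a
      change wordLength _ (ψ.symm (ψ x) : H × G₀).2 ≤
        wordLength _ (ψ x : H × G₀).2 + wordLength _ (ψ x : H × G₀).1
      rw [ψ.symm_apply_apply, hψ x]
      have h₁ := hφ ⟨(x : H × G₀).1, (Subgroup.mem_prod.mp x.2).1⟩
      have h₂ := wordLength_inv_le hC (φ ⟨(x : H × G₀).1, (Subgroup.mem_prod.mp x.2).1⟩)
      have h₃ := wordLength_mul_le hC (φ ⟨(x : H × G₀).1, (Subgroup.mem_prod.mp x.2).1⟩)⁻¹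
        (φ ⟨(x : H × G₀).1, (Subgroup.mem_prod.mp x.2).1⟩ * (x : H × G₀).2)
      rw [inv_mul_cancel_left] at h₃
      dsimp only at h₁ h₂ h₃ ⊢
      omega
  · have hgen : ∀ x ∈ D, (∃ y ∈ (T : Set H), x = HNNExtension.of (y, 1)) ∨
        (∃ c ∈ (C : Set G₀), x = HNNExtension.of (1, c)) ∨ x = HNNExtension.t := by
      rintro x ((⟨y, hy, rfl⟩ | ⟨c, hc, rfl⟩) | rfl)
      exacts [Or.inl ⟨y, hy, rfl⟩, Or.inr (Or.inl ⟨c, hc, rfl⟩), Or.inr (Or.inr rfl)]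
    intro x hx
    rcases hw x hx with hx | hx
    · rcases hgen x hx with ⟨y, hy, rfl⟩ | ⟨c, hc, rfl⟩ | rfl
      · exact Or.inl ⟨_, rfl, by simpa [wordLength_one] using wordLength_le_one (Or.inl hy)⟩
      · exact Or.inl ⟨_, rfl, by simpa [wordLength_one] using wordLength_le_one (Or.inl hc)⟩
      · exact Or.inr ⟨1, by simp⟩
    · rcases hgen _ hx with ⟨y, hy, h⟩ | ⟨c, hc, h⟩ | h
      · refine Or.inl ⟨(y, 1)⁻¹, by rw [map_inv, ← h, inv_inv], ?_⟩
        simpa [wordLength_one] using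
          wordLength_le_one (S := (T : Set H)) (Or.inr (Set.inv_mem_inv.mpr hy))
      · refine Or.inl ⟨(1, c)⁻¹, by rw [map_inv, ← h, inv_inv], ?_⟩
        simpa [wordLength_one] using
          wordLength_le_one (S := (C : Set G₀)) (Or.inr (Set.inv_mem_inv.mpr hc))
      · exact Or.inr ⟨-1, by simp [← h]⟩
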